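/- Every continuous distance equality preserving map h : ℝ^m → ℝ^n with m > 1 is a homometry: there exists λ ≥ 0 with ‖h(x) - h(y)‖ = λ‖x - y‖ for all x, y ∈ ℝ^m. -/

import Mathlib

open Polynomial Filter Topology

lemma aux_exists_lin {E H : Type*} [NormedAddCommGroup E] [NormedAddCommGroup H]
    [InnerProductSpace ℝ H] (h : E → H) (h0 : h 0 = 0)
    (hspan : Submodule.span ℝ (Set.range h) = ⊤)
    (hh : ∀ x y z w, ‖x - y‖ = ‖z - w‖ → ‖h x - h y‖ = ‖h z - h w‖)
    (T : E → E) (hT : ∀ x y, ‖T x - T y‖ = ‖x - y‖) :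
    ∃ U : H →ₗ[ℝ] H, (∀ x, U (h x) = h (T x) - h (T 0)) ∧
      ∀ a b, inner ℝ (U a) (U b) = inner ℝ a b := by
  set L1 := Finsupp.linearCombination ℝ h with hL1
  set L2 := Finsupp.linearCombination ℝ (fun x => h (T x) - h (T 0)) with hL2
  have key : ∀ x y, inner ℝ (h (T x) - h (T 0)) (h (T y) - h (T 0)) = inner ℝ (h x) (h y) := by
    intro x y
    have e1 := hh (T x) (T 0) x 0 (hT _ _)
    have e2 := hh (T y) (T 0) y 0 (hT _ _)
    have e3 := hh (T x) (T y) x y (hT _ _)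
    have e4 : h (T x) - h (T y) = (h (T x) - h (T 0)) - (h (T y) - h (T 0)) := by abel
    rw [h0, sub_zero] at e1 e2
    have f1 := norm_sub_sq_real (h (T x) - h (T 0)) (h (T y) - h (T 0))
    have f2 := norm_sub_sq_real (h x) (h y)
    rw [← e4, e1, e2, e3] at f1
    linarith
  have hinner : ∀ a b, inner ℝ (L2 a) (L2 b) = inner ℝ (L1 a) (L1 b) := by
    intro a b
    induction a using Finsupp.induction_linear with
    | zero => simp
    | add f g hf hg => simp only [map_add, inner_add_left, hf, hg]
    | single x c =>
      induction b using Finsupp.induction_linear with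
      | zero => simp
      | add f g hf hg => simp only [map_add, inner_add_right, hf, hg]
      | single y d =>
        simp only [hL1, hL2, Finsupp.linearCombination_single, inner_smul_left,
          inner_smul_right, key]
  have hker : ∀ a, L1 a = 0 → L2 a = 0 := by
    intro a ha
    have := hinner a a
    rw [ha, inner_zero_left] at this
    exact inner_self_eq_zero.1 this
  have hr : LinearMap.range L1 = ⊤ := by
    rw [hL1, Finsupp.range_linearCombination, hspan]
  obtain ⟨s, hs⟩ := LinearMap.exists_rightInverse_of_surjective L1 hr
  have hs' : ∀ z, L1 (s z) = z := fun z => by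
    simpa using LinearMap.congr_fun hs z
  refine ⟨L2.comp s, ?_, ?_⟩
  · intro x
    have := hker (s (h x) - Finsupp.single x 1) (by
      rw [map_sub, hs']; simp [hL1])
    rw [map_sub, sub_eq_zero] at this
    simpa [hL2] using this
  · intro a b
    simp only [LinearMap.comp_apply]
    rw [hinner, hs', hs']

lemma aux_Q {A : Type*} [NormedRing A] [NormedAlgebra ℝ A] (p : ℝ[X]) :
    ∃ Q : A → A → A, (∀ x, Continuous (Q x)) ∧ (∀ x, Q x x = aeval x (derivative p)) ∧
      ∀ x y, Commute x y → aeval x p - aeval y p = (x - y) * Q x y := by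
  induction p using Polynomial.induction_on' with
  | add p q hp hq =>
    obtain ⟨P, hP1, hP2, hP3⟩ := hp
    obtain ⟨Q, hQ1, hQ2, hQ3⟩ := hq
    refine ⟨fun x y => P x y + Q x y, fun x => (hP1 x).add (hQ1 x), ?_, ?_⟩
    · intro x; simp [hP2, hQ2]
    · intro x y hxy
      rw [mul_add, ← hP3 x y hxy, ← hQ3 x y hxy]; simp only [map_add]; abel
  | monomial n a =>
    refine ⟨fun x y => a • ∑ i ∈ Finset.range n, x ^ i * y ^ (n - 1 - i), ?_, ?_, ?_⟩
    · intro x; fun_prop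
    · intro x
      have : ∀ i ∈ Finset.range n, x ^ i * x ^ (n - 1 - i) = x ^ (n - 1) := by
        intro i hi
        rw [← pow_add]; congr 1; have := Finset.mem_range.1 hi; omega
      beta_reduce
      rw [Finset.sum_congr rfl this, derivative_monomial]
      simp [aeval_monomial, Algebra.smul_def, mul_assoc]
    · intro x y hxy
      rw [mul_smul_comm, hxy.mul_geom_sum₂]
      simp [aeval_monomial, Algebra.smul_def, mul_sub]

lemma aux_near {A : Type*} [NormedRing A] [NormedAlgebra ℝ A] [CompleteSpace A] (p : ℝ[X])
    (hp : p.Separable) (x : A) (hx : aeval x p = 0) :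
    ∀ᶠ y in 𝓝 x, Commute x y → aeval y p = 0 → y = x := by
  obtain ⟨Q, h1, h2, h3⟩ := aux_Q (A := A) p
  obtain ⟨a, b, hab⟩ := hp
  have hab' : b * derivative p = 1 - a * p := by rw [← hab]; ring
  have e1 : aeval x b * aeval x (derivative p) = 1 := by
    rw [← map_mul, hab']; simp [hx]
  have e2 : aeval x (derivative p) * aeval x b = 1 := by
    rw [← map_mul, mul_comm, hab']; simp [hx]
  have hu : IsUnit (Q x x) := by
    rw [h2]; exact ⟨⟨_, _, e2, e1⟩, rfl⟩
  have := (h1 x).continuousAt.eventually (Units.isOpen.mem_nhds hu)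
  filter_upwards [this] with y hy hc hy0
  have e := h3 x y hc
  rw [hx, hy0, sub_zero] at e
  have hy' : IsUnit (Q x y) := hy
  have := (hy'.mul_left_eq_zero).1 e.symm
  exact (sub_eq_zero.1 this).symm

lemma aux_semisimple {H : Type*} [NormedAddCommGroup H] [InnerProductSpace ℝ H]
    [FiniteDimensional ℝ H] (U : Module.End ℝ H)
    (hU : ∀ a b, inner ℝ (U a) (U b) = inner ℝ a b) : (minpoly ℝ U).Separable := by
  rw [PerfectField.separable_iff_squarefree]
  apply Module.End.IsSemisimple.minpoly_squarefree
  rw [Module.End.isSemisimple_iff]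
  intro W hW
  have hinj : Function.Injective U := by
    rw [injective_iff_map_eq_zero]
    intro a ha
    have := hU a a
    rw [ha, inner_zero_left] at this
    exact inner_self_eq_zero.1 this.symm
  have hle : W.map U ≤ W := Submodule.map_le_iff_le_comap.2 hW
  have heq : W.map U = W := by
    apply Submodule.eq_of_le_of_finrank_eq hle
    exact (Submodule.equivMapOfInjective U hinj W).finrank_eq.symm
  refine ⟨Wᗮ, ?_, Submodule.isCompl_orthogonal W⟩
  intro y hy
  rw [Submodule.mem_comap, Submodule.mem_orthogonal]
  intro w hw
  rw [← heq] at hw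
  obtain ⟨w', hw', rfl⟩ := hw
  rw [hU]
  exact (Submodule.mem_orthogonal _ _).1 hy w' hw'

lemma aux_conj {A : Type*} [Ring A] [Algebra ℝ A] (p : ℝ[X]) (r a b : A)
    (hr : b * r = r * a) : aeval b p * r = r * aeval a p := by
  have hpow : ∀ n : ℕ, b ^ n * r = r * a ^ n := by
    intro n
    have : SemiconjBy r a b := hr.symm
    exact (this.pow_right n).symm
  induction p using Polynomial.induction_on' with
  | add p q hp hq => simp only [map_add, add_mul, mul_add, hp, hq]
  | monomial n c =>
    simp only [aeval_monomial, ← Algebra.smul_def, smul_mul_assoc, mul_smul_comm, hpow]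

lemma aux_add {E H : Type*} [NormedAddCommGroup E] [InnerProductSpace ℝ E]
    [NormedAddCommGroup H] [InnerProductSpace ℝ H] [FiniteDimensional ℝ H]
    (hE : 1 < Module.rank ℝ E) (h : E → H) (h0 : h 0 = 0) (hc : Continuous h)
    (hspan : Submodule.span ℝ (Set.range h) = ⊤)
    (hh : ∀ x y z w, ‖x - y‖ = ‖z - w‖ → ‖h x - h y‖ = ‖h z - h w‖) :
    ∀ x u, h (x + u) = h x + h u := by
  have hext : ∀ A B : Module.End ℝ H, (∀ x, A (h x) = B (h x)) → A = B := by
    intro A B hAB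
    apply LinearMap.ext_on_range hspan hAB
  have hex := fun v : E => aux_exists_lin h h0 hspan hh (fun x => x + v) (by intro x y; simp)
  choose U hU hUi using hex
  simp only [zero_add] at hU
  have hmul : ∀ v w, (U v : Module.End ℝ H) * U w = U (v + w) := by
    intro v w
    apply hext
    intro x
    rw [Module.End.mul_apply, hU, map_sub, hU, hU, hU]
    rw [add_comm w v, show x + w + v = x + (v + w) by abel]
    abel
  have hzero : (U 0 : Module.End ℝ H) = 1 := by
    apply hext; intro x; rw [hU]; simp [h0]
  have hcomm : ∀ v w, Commute (U v : Module.End ℝ H) (U w) := by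
    intro v w
    rw [Commute, SemiconjBy, hmul, hmul, add_comm]
  have hann : ∀ v w, ‖v‖ = ‖w‖ → aeval (U w : Module.End ℝ H) (minpoly ℝ (U v : Module.End ℝ H)) = 0 := by
    intro v w hvw
    let R := (Submodule.span ℝ {v - w})ᗮ.reflection
    have hRv : R v = w := Submodule.reflection_sub hvw
    have hRR : ∀ x, R (R x) = x := fun x => Submodule.reflection_reflection _ x
    obtain ⟨r, hr, -⟩ := aux_exists_lin h h0 hspan hh R (by
      intro x y; rw [← map_sub]; exact R.norm_map _)
    have hr' : ∀ x, r (h x) = h (R x) := by intro x; rw [hr]; simp [h0]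
    have hrr : (r : Module.End ℝ H) * r = 1 := by
      apply hext; intro x; rw [Module.End.mul_apply, hr', hr', hRR]; rfl
    have hc := aux_conj (minpoly ℝ (U v : Module.End ℝ H)) (r : Module.End ℝ H) (U v) (U w) (by
      apply hext
      intro x
      rw [Module.End.mul_apply, Module.End.mul_apply, hr', hU, hU, map_sub, hr', hr', map_add, hRv])
    rw [minpoly.aeval, mul_zero] at hc
    have := congrArg (· * (r : Module.End ℝ H)) hc
    simpa [mul_assoc, hrr] using this
  let Φ : Module.End ℝ H ≃ₐ[ℝ] (H →L[ℝ] H) := Module.End.toContinuousLinearMap H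
  have hΦ : ∀ A x, Φ A x = A x := fun A x => rfl
  have hcont : Continuous (fun v => Φ (U v)) := by
    rw [continuous_clm_apply]
    intro y
    simp only [hΦ]
    have hy : y ∈ Submodule.span ℝ (Set.range h) := by rw [hspan]; trivial
    induction hy using Submodule.span_induction with
    | mem y hy =>
      obtain ⟨x, rfl⟩ := hy
      simp only [hU]; fun_prop
    | zero => simp only [map_zero]; fun_prop
    | add a b _ _ ha hb => simp only [map_add]; exact ha.add hb
    | smul c a _ ha => simp only [map_smul]; exact ha.const_smul c
  have hloc : ∀ v, ∀ᶠ w in 𝓝 v, ‖w‖ = ‖v‖ → U w = U v := by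
    intro v
    have := aux_near (minpoly ℝ (U v : Module.End ℝ H)) (aux_semisimple (U v) (hUi v)) (Φ (U v))
      (by rw [Polynomial.aeval_algHom_apply Φ, minpoly.aeval, map_zero])
    filter_upwards [hcont.continuousAt.eventually this] with w hw hn
    apply Φ.injective
    apply hw
    · exact (hcomm v w).map Φ
    · rw [Polynomial.aeval_algHom_apply Φ, hann v w hn.symm, map_zero]
  have hsph : ∀ v w, ‖v‖ = ‖w‖ → U v = U w := by
    intro v w hvw
    have hpre := isPreconnected_sphere hE (0 : E) ‖w‖
    have : PreconnectedSpace (Metric.sphere (0 : E) ‖w‖) := Subtype.preconnectedSpace hpre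
    have hlc : IsLocallyConstant (fun x : Metric.sphere (0 : E) ‖w‖ => U x.1) := by
      rw [IsLocallyConstant.iff_eventually_eq]
      intro x
      have := continuous_subtype_val.continuousAt.eventually (hloc x.1)
      filter_upwards [this] with y hy
      apply hy
      rw [mem_sphere_zero_iff_norm.1 x.2, mem_sphere_zero_iff_norm.1 y.2]
    exact hlc.apply_eq_of_preconnectedSpace ⟨v, by simp [hvw]⟩ ⟨w, by simp⟩
  intro x u
  have h1 : (U u : Module.End ℝ H) = 1 := by
    have e : u = (1/2 : ℝ) • u + (1/2 : ℝ) • u := by rw [← add_smul]; norm_num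
    have e2 : U ((1/2 : ℝ) • u) = U (-((1/2 : ℝ) • u)) := hsph _ _ (norm_neg _).symm
    rw [e, ← hmul]
    nth_rewrite 1 [e2]
    rw [hmul, neg_add_cancel, hzero]
  have := hU u x
  rw [h1, Module.End.one_apply] at this
  rw [this]; abel

theorem continuous_dep_is_homometry (m n : ℕ) (hm : 1 < m)
    (h : EuclideanSpace ℝ (Fin m) → EuclideanSpace ℝ (Fin n))
    (hcont : Continuous h)
    (hh : ∀ x y z w, ‖x - y‖ = ‖z - w‖ → ‖h x - h y‖ = ‖h z - h w‖) :
    ∃ lam : ℝ, 0 ≤ lam ∧ ∀ x y, ‖h x - h y‖ = lam * ‖x - y‖ := by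
  let S := Submodule.span ℝ (Set.range fun x => h x - h 0)
  let k : EuclideanSpace ℝ (Fin m) → S := fun x =>
    ⟨h x - h 0, Submodule.subset_span ⟨x, rfl⟩⟩
  have hk : ∀ x y, ‖k x - k y‖ = ‖h x - h y‖ := by
    intro x y
    rw [Submodule.coe_norm, Submodule.coe_sub]
    simp [k]
  have k0 : k 0 = 0 := by ext1; simp [k]
  have kc : Continuous k := by
    apply Continuous.subtype_mk; fun_prop
  have kspan : Submodule.span ℝ (Set.range k) = ⊤ := by
    have := Submodule.span_span_coe_preimage (R := ℝ) (s := Set.range fun x => h x - h 0)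
    convert this using 2
    ext y
    simp [k, Subtype.ext_iff]
  have hadd := aux_add (by
    rw [← Module.finrank_eq_rank, finrank_euclideanSpace_fin]; exact_mod_cast hm)
    k k0 kc kspan (by intro x y z w e; rw [hk, hk]; exact hh x y z w e)
  let f : EuclideanSpace ℝ (Fin m) →+ S := AddMonoidHom.mk' k hadd
  let L := f.toRealLinearMap kc
  have hL : ∀ x, L x = k x := fun x => rfl
  let e : EuclideanSpace ℝ (Fin m) := EuclideanSpace.single ⟨0, by omega⟩ 1
  have he : ‖e‖ = 1 := by simp [e]
  refine ⟨‖k e‖, norm_nonneg _, ?_⟩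
  intro x y
  have h1 := hh x y (‖x - y‖ • e) 0 (by simp [norm_smul, he])
  rw [h1, ← hk, k0, sub_zero, ← hL, map_smul, norm_smul, hL, norm_norm, mul_comm]
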